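/- arXiv:2212.03445 — 2 statements merged into one kernel-verified Lean document; each statement's English description precedes it below -/
import Mathlib

section
/- Fix an integer N ≥ 2, reals μ > 0, B > 0, G_F ≥ 0 and G > 0. For ρ > 0 define p₁(ρ) = [1 − (2/(1+μ))e^{−μ/ρ} + ((1−μ)/(1+μ))e^{−2μ/((1−μ)ρ)}] / [1 − e^{−μ/ρ}/(μ+1)] when 0 < μ < 1, p₁(ρ) = [1 − (2/(1+μ))e^{−μ/ρ}] / [1 − e^{−μ/ρ}/(μ+1)] when μ ≥ 1, and define the retransmission attempt-rate update Φ(ρ) = {1 − [(G/B)(1 − e^{−μ/ρ}/(μ+1))] / [(N−1)(1 − e^{−μ/ρ}(1 − (μ/(μ+1))(G/B)))]}·G_F + p₁(ρ)·[(G/B)(1 − e^{−μ/ρ}/(μ+1))] / [1 − e^{−μ/ρ}(1 − (μ/(μ+1))(G/B))]. Then lim_{ρ→∞} Φ(ρ) = (1 − 1/(N−1))·G_F + p₁*, where p₁* = 0 if 0 < μ ≤ 1 and p₁* = 1 − 1/μ if μ > 1. In particular the limit does not depend on the previous attempt rate G, so in the noiseless limit all attempt rates seen in successive retransmissions are equal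 to (1 − 1/(N−1))G_F + p₁*. -/
open Filter Real

theorem tendsto_exp_const_div_atTop (c : ℝ) :
    Filter.Tendsto (fun ρ : ℝ => Real.exp (c / ρ)) Filter.atTop (nhds 1) := by
  simpa [Function.comp_def] using (Real.continuous_exp.tendsto 0).comp
    (tendsto_const_nhds.div_atTop Filter.tendsto_id :
      Filter.Tendsto (fun ρ : ℝ => c / ρ) Filter.atTop (nhds 0))

/-- Theorem 1 of the paper: in the noiseless limit ρ → ∞, the attempt-rate update Φ
tends to (1 − 1/(N−1))·G_F + p₁*, independently of the previous attempt rate G. -/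
theorem attempt_rate_limit_noiseless
    (N : ℕ) (hN : 2 ≤ N) (μ B GF G : ℝ)
    (hμ : 0 < μ) (hB : 0 < B) (hGF : 0 ≤ GF) (hG : 0 < G) :
    Filter.Tendsto
      (fun ρ : ℝ =>
        let p₁ : ℝ :=
          if μ < 1 then
            (1 - (2 / (1 + μ)) * Real.exp (-μ / ρ)
              + ((1 - μ) / (1 + μ)) * Real.exp (-2 * μ / ((1 - μ) * ρ)))
            / (1 - Real.exp (-μ / ρ) / (μ + 1))
          else
            (1 - (2 / (1 + μ)) * Real.exp (-μ / ρ))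
            / (1 - Real.exp (-μ / ρ) / (μ + 1))
        (1 - ((G / B) * (1 - Real.exp (-μ / ρ) / (μ + 1)))
              / (((N : ℝ) - 1) *
                  (1 - Real.exp (-μ / ρ) * (1 - (μ / (μ + 1)) * (G / B))))) * GF
          + p₁ * ((G / B) * (1 - Real.exp (-μ / ρ) / (μ + 1)))
              / (1 - Real.exp (-μ / ρ) * (1 - (μ / (μ + 1)) * (G / B))))
      Filter.atTop
      (nhds ((1 - 1 / ((N : ℝ) - 1)) * GF
        + (if μ ≤ 1 then (0 : ℝ) else 1 - 1 / μ))) := by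
  have hN' : (N : ℝ) - 1 ≠ 0 := by
    have : (2 : ℝ) ≤ N := by exact_mod_cast hN
    linarith
  have hμ1 : μ + 1 ≠ 0 := by positivity
  have hμ1' : 1 + μ ≠ 0 := by positivity
  have he := tendsto_exp_const_div_atTop (-μ)
  have hnum := (he.div_const (μ + 1)).const_sub 1
  have hden := (he.mul_const (1 - (μ / (μ + 1)) * (G / B))).const_sub 1
  have hnum_eq : 1 - 1 / (μ + 1) = μ / (μ + 1) := by field_simp; ring
  have hnum0 : 1 - 1 / (μ + 1) ≠ 0 := by
    rw [hnum_eq]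
    positivity
  have hden_eq : 1 - 1 * (1 - (μ / (μ + 1)) * (G / B)) = (μ / (μ + 1)) * (G / B) := by ring
  have hden0 : 1 - 1 * (1 - (μ / (μ + 1)) * (G / B)) ≠ 0 := by
    rw [hden_eq]
    positivity
  have hfirst := (((hnum.const_mul (G / B)).div (hden.const_mul ((N : ℝ) - 1))
    (mul_ne_zero hN' hden0)).const_sub 1).mul_const GF
  have hlin := (he.const_mul (2 / (1 + μ))).const_sub 1
  by_cases h : μ < 1
  · have h1 : 1 - μ ≠ 0 := by linarith
    have he2 : Filter.Tendsto (fun ρ : ℝ => Real.exp (-2 * μ / ((1 - μ) * ρ)))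
        Filter.atTop (nhds 1) := by
      simpa only [div_mul_eq_div_div] using tendsto_exp_const_div_atTop (-2 * μ / (1 - μ))
    simp only [if_pos h, if_pos h.le]
    have hp := (hlin.add (he2.const_mul ((1 - μ) / (1 + μ)))).div hnum hnum0
    convert hfirst.add ((hp.mul (hnum.const_mul (G / B))).div hden hden0) using 2
    · rfl
    have hz : 1 - 2 / (1 + μ) * 1 + (1 - μ) / (1 + μ) * 1 = 0 := by field_simp; ring
    rw [hz, hden_eq, hnum_eq]
    field_simp
    ring
  · simp only [if_neg h]
    have hp := hlin.div hnum hnum0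
    convert hfirst.add ((hp.mul (hnum.const_mul (G / B))).div hden hden0) using 2
    · rfl
    have hlim : (if μ ≤ 1 then (0 : ℝ) else 1 - 1 / μ) = 1 - 1 / μ := by
      split_ifs with h'
      · rw [le_antisymm h' (not_lt.mp h)]; norm_num
      · rfl
    rw [hlim, hden_eq, hnum_eq]
    field_simp
    ring
end

section
/- Let 0 < μ < 1 and a ≥ 0, and let U = {(x,y) ∈ (0,∞)² : x ≤ μ(a+y) and y ≤ μ(a+x)}. Then ∫∫_U e^{−x−y} dx dy = 1 − (2/(1+μ))·e^{−μa} + ((1−μ)/(1+μ))·e^{−2μa/(1−μ)}. -/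
open Real MeasureTheory

/-- The integral of the exponential of an affine function with nonzero slope. -/
lemma integral_exp_affine (k b p q : ℝ) (hk : k ≠ 0) :
    ∫ x in p..q, Real.exp (k * x + b) = (Real.exp (k * q + b) - Real.exp (k * p + b)) / k := by
  have h : ∀ x ∈ Set.uIcc p q,
      HasDerivAt (fun x => Real.exp (k * x + b) / k) (Real.exp (k * x + b)) x := by
    intro x _
    have h1 : HasDerivAt (fun x : ℝ => k * x + b) k x := by
      simpa using ((hasDerivAt_id x).const_mul k).add_const b
    have h2 := h1.exp.div_const k
    rwa [mul_div_assoc, div_self hk, mul_one] at h2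
  rw [intervalIntegral.integral_eq_sub_of_hasDerivAt h
    (Continuous.intervalIntegrable (by fun_prop) _ _)]
  ring

/-- A set squeezed between `Ioc m u` and `Icc m u` carries the interval integral. -/
lemma setIntegral_exp_of_between (x m u : ℝ) (hmu : m ≤ u) (s : Set ℝ)
    (h₁ : Set.Ioc m u ⊆ s) (h₂ : s ⊆ Set.Icc m u) :
    ∫ y in s, Real.exp (-x - y) = Real.exp (-x - m) - Real.exp (-x - u) := by
  have hs : s =ᵐ[volume] Set.Ioc m u :=
    (h₂.eventuallyLE.trans Ioc_ae_eq_Icc.symm.le).antisymm h₁.eventuallyLE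
  have h := integral_exp_affine (-1) (-x) m u (by norm_num)
  rw [setIntegral_congr_set hs, ← intervalIntegral.integral_of_le hmu]
  have e : ∀ y : ℝ, -x - y = -1 * y + -x := fun y => by ring
  simp only [e, h]
  ring

/-- The iterated form of the integral of `e^{-x-y}` over the joint failure region. -/
lemma integral_failure_region_eq_intervalIntegral (μ a : ℝ) (hμ0 : 0 < μ) (hμ1 : μ < 1)
    (ha : 0 ≤ a) :
    (∫ p in {p : ℝ × ℝ | 0 < p.1 ∧ 0 < p.2 ∧ p.1 ≤ μ * (a + p.2) ∧ p.2 ≤ μ * (a + p.1)},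
        Real.exp (-p.1 - p.2))
      = ∫ x in (0 : ℝ)..(μ * a / (1 - μ)),
          (Real.exp (-x - max 0 (x / μ - a)) - Real.exp (-x - μ * (a + x))) := by
  set S : Set (ℝ × ℝ) :=
    {p | 0 < p.1 ∧ 0 < p.2 ∧ p.1 ≤ μ * (a + p.2) ∧ p.2 ≤ μ * (a + p.1)} with hS
  set c := μ * a / (1 - μ) with hc
  have h1μ : 0 < 1 - μ := by linarith
  have hc0 : 0 ≤ c := by positivity
  have hcμ : c * (1 - μ) = μ * a := div_mul_cancel₀ _ h1μ.ne'
  have hSm : MeasurableSet S := by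
    simp only [hS, Set.ofPred_and]
    refine .inter ?_ (.inter ?_ (.inter ?_ ?_))
    · exact measurableSet_lt (by fun_prop) (by fun_prop)
    · exact measurableSet_lt (by fun_prop) (by fun_prop)
    · exact measurableSet_le (by fun_prop) (by fun_prop)
    · exact measurableSet_le (by fun_prop) (by fun_prop)
  have hbound : ∀ x y : ℝ, x ≤ μ * (a + y) → y ≤ μ * (a + x) → x ≤ c := by
    intro x y h1 h2
    rw [hc, le_div_iff₀ h1μ]
    nlinarith [mul_le_mul_of_nonneg_left h2 hμ0.le]
  have hSsub : S ⊆ Set.Icc ((0 : ℝ), (0 : ℝ)) (c, c) := by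
    rintro ⟨x, y⟩ ⟨hx, hy, h1, h2⟩
    exact ⟨⟨hx.le, hy.le⟩, hbound x y h1 h2, hbound y x h2 h1⟩
  have hint : IntegrableOn (fun p : ℝ × ℝ => Real.exp (-p.1 - p.2)) S :=
    (Continuous.integrableOn_Icc (by fun_prop)).mono_set hSsub
  rw [← integral_indicator hSm, Measure.volume_eq_prod,
    integral_prod _ ((integrable_indicator_iff hSm).2 hint),
    intervalIntegral.integral_of_le hc0, ← integral_indicator measurableSet_Ioc]
  congr 1 with x
  by_cases hx : x ∈ Set.Ioc 0 c
  · have hslice : MeasurableSet {y : ℝ | (x, y) ∈ S} := measurable_prodMk_left hSm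
    have hxμ : x * (1 - μ) ≤ μ * a := hcμ ▸ mul_le_mul_of_nonneg_right hx.2 h1μ.le
    rw [Set.indicator_of_mem hx]
    have hmu : max 0 (x / μ - a) ≤ μ * (a + x) := by
      refine max_le (mul_nonneg hμ0.le (by linarith [hx.1])) ?_
      rw [sub_le_iff_le_add, div_le_iff₀ hμ0]
      nlinarith
    have hiff : ∀ y : ℝ, x / μ - a ≤ y ↔ x ≤ μ * (a + y) := by
      intro y
      rw [sub_le_iff_le_add, div_le_iff₀ hμ0, mul_comm, add_comm y]
    rw [← setIntegral_exp_of_between x _ _ hmu {y | (x, y) ∈ S}, ← integral_indicator hslice]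
    · rfl
    · rintro y ⟨h1, h2⟩
      exact ⟨hx.1, (le_max_left _ _).trans_lt h1,
        (hiff y).1 ((le_max_right _ _).trans h1.le), h2⟩
    · rintro y ⟨-, hy, h1, h2⟩
      exact ⟨max_le hy.le ((hiff y).2 h1), h2⟩
  · rw [Set.indicator_of_notMem hx]
    refine integral_eq_zero_of_ae (Filter.Eventually.of_forall fun y => ?_)
    exact Set.indicator_of_notMem (fun h => hx ⟨h.1, hbound x y h.2.2.1 h.2.2.2⟩) _

/-- Joint failure probability Pr{E, H | S₁} for two colliding packets (case 0 < μ < 1):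
∫∫_U e^{−x−y} dx dy = 1 − (2/(1+μ))e^{−μa} + ((1−μ)/(1+μ))e^{−2μa/(1−μ)}, where U is
the set of gain pairs for which both SINRs are at most μ. -/
theorem joint_failure_integral_mu_lt_one (μ a : ℝ) (hμ0 : 0 < μ) (hμ1 : μ < 1) (ha : 0 ≤ a) :
    (∫ p in {p : ℝ × ℝ | 0 < p.1 ∧ 0 < p.2 ∧ p.1 ≤ μ * (a + p.2) ∧ p.2 ≤ μ * (a + p.1)},
        Real.exp (-p.1 - p.2))
      = 1 - (2 / (1 + μ)) * Real.exp (-(μ * a))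
        + ((1 - μ) / (1 + μ)) * Real.exp (-(2 * μ * a) / (1 - μ)) := by
  rw [integral_failure_region_eq_intervalIntegral μ a hμ0 hμ1 ha]
  have h1μ : 0 < 1 - μ := by linarith
  have hμa : 0 ≤ μ * a := by positivity
  have hμac : μ * a ≤ μ * a / (1 - μ) := le_div_self hμa h1μ (by linarith)
  have hcont : Continuous fun x : ℝ => Real.exp (-x - max 0 (x / μ - a)) := by fun_prop
  have hlow : ∫ x in (0 : ℝ)..(μ * a), Real.exp (-x - max 0 (x / μ - a))
      = ∫ x in (0 : ℝ)..(μ * a), Real.exp (-1 * x + 0) := by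
    refine intervalIntegral.integral_congr fun x hx => ?_
    rw [Set.uIcc_of_le hμa] at hx
    have : x / μ - a ≤ 0 := by
      rw [sub_nonpos, div_le_iff₀ hμ0, mul_comm]
      exact hx.2
    simp only [max_eq_left this]
    ring_nf
  have hhigh : ∫ x in (μ * a)..(μ * a / (1 - μ)), Real.exp (-x - max 0 (x / μ - a))
      = ∫ x in (μ * a)..(μ * a / (1 - μ)), Real.exp (-((1 + μ) / μ) * x + a) := by
    refine intervalIntegral.integral_congr fun x hx => ?_
    rw [Set.uIcc_of_le hμac] at hx
    have : 0 ≤ x / μ - a := by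
      rw [sub_nonneg, le_div_iff₀ hμ0, mul_comm]
      exact hx.1
    simp only [max_eq_right this]
    congr 1
    field_simp
    ring
  have hupper : ∀ x : ℝ, -x - μ * (a + x) = -(1 + μ) * x + -(μ * a) := fun x => by ring
  rw [intervalIntegral.integral_sub (hcont.intervalIntegrable _ _)
      (Continuous.intervalIntegrable (by fun_prop) _ _),
    ← intervalIntegral.integral_add_adjacent_intervals (hcont.intervalIntegrable 0 (μ * a))
      (hcont.intervalIntegrable _ _), hlow, hhigh]
  simp only [hupper]
  rw [integral_exp_affine _ _ _ _ (by norm_num),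
    integral_exp_affine _ _ _ _ (neg_ne_zero.2 (by positivity)),
    integral_exp_affine _ _ _ _ (neg_ne_zero.2 (by positivity))]
  have e1 : -((1 + μ) / μ) * (μ * a / (1 - μ)) + a = -(2 * μ * a) / (1 - μ) := by
    field_simp
    ring
  have e2 : -((1 + μ) / μ) * (μ * a) + a = -(μ * a) := by
    field_simp
    ring
  have e3 : -(1 + μ) * (μ * a / (1 - μ)) + -(μ * a) = -(2 * μ * a) / (1 - μ) := by
    field_simp
    ring
  have e4 : -1 * (μ * a) + 0 = -(μ * a) := by ring
  rw [e1, e2, e3, e4]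
  simp only [mul_zero, add_zero, zero_add, Real.exp_zero]
  field_simp
  ring
end
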